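/- arXiv:2009.01084 — 4 statements merged into one kernel-verified Lean document; each statement's English description precedes it below -/
import Mathlib

section
/- For every integer n ≥ 15, there exists a prime number p with n ≤ p < 2n such that p ≡ 5 (mod 8). -/
open Finset ArithmeticFunction

/-- The sum of `log n` over `0 < n ≤ N` with `n % m = a`. -/
noncomputable def logSum (m a N : ℕ) : ℝ := ∑ n ∈ Ioc 0 N with n % m = a, Real.log n

/-- The number of `0 < k ≤ y` with `(q * k) % m = a`. -/
def residueCount (m a q y : ℕ) : ℕ := #{k ∈ Ioc 0 y | (q * k) % m = a}

theorem card_filter_residue_dvd (m a q N : ℕ) (hq : 0 < q) :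
    #{n ∈ Ioc 0 N | n % m = a ∧ q ∣ n} = residueCount m a q (N / q) := by
  symm
  refine card_bij (fun k _ ↦ q * k) ?_ ?_ ?_
  · intro k hk
    simp only [mem_filter, mem_Ioc, Nat.le_div_iff_mul_le hq] at hk ⊢
    exact ⟨⟨Nat.mul_pos hq hk.1.1, by linarith [hk.1.2, mul_comm q k]⟩, hk.2, dvd_mul_right q k⟩
  · intro k _ l _ h
    exact Nat.eq_of_mul_eq_mul_left hq h
  · intro n hn
    simp only [mem_filter, mem_Ioc] at hn
    obtain ⟨⟨h0, hN⟩, hm, k, rfl⟩ := hn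
    refine ⟨k, ?_, rfl⟩
    simp only [mem_filter, mem_Ioc, Nat.le_div_iff_mul_le hq]
    exact ⟨⟨Nat.pos_of_mul_pos_left h0, by linarith [mul_comm q k]⟩, hm⟩

theorem logSum_eq_sum_vonMangoldt (m a : ℕ) {N X : ℕ} (h : N ≤ X) :
    logSum m a N = ∑ q ∈ Ioc 0 X, vonMangoldt q * residueCount m a q (N / q) := by
  have hlog : ∀ n ∈ Ioc 0 N,
      Real.log n = ∑ q ∈ Ioc 0 X, if q ∣ n then vonMangoldt q else 0 := by
    intro n hn
    rw [← vonMangoldt_sum, ← sum_filter]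
    refine sum_congr ?_ fun _ _ ↦ rfl
    ext q
    simp only [mem_Ioc] at hn
    simp only [Nat.mem_divisors, mem_filter, mem_Ioc]
    constructor
    · rintro ⟨hd, -⟩
      have := Nat.le_of_dvd hn.1 hd
      exact ⟨⟨Nat.pos_of_dvd_of_pos hd hn.1, by omega⟩, hd⟩
    · rintro ⟨-, hd⟩
      exact ⟨hd, by omega⟩
  rw [logSum, sum_congr rfl fun n hn ↦ hlog n (mem_filter.mp hn).1, sum_comm]
  refine sum_congr rfl fun q hq ↦ ?_
  rw [← sum_filter, sum_const, filter_filter,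
    card_filter_residue_dvd m a q N (mem_Ioc.mp hq).1, nsmul_eq_mul, mul_comm]

theorem card_filter_mod_eight (r y : ℕ) (h0 : 0 < r) (h8 : r < 8) :
    #{k ∈ Ioc 0 y | k % 8 = r} = (y + 8 - r) / 8 := by
  induction y with
  | zero => simp; omega
  | succ y ih =>
    rw [← insert_Ioc_right_eq_Ioc_add_one (Nat.zero_le y), filter_insert]
    split_ifs with h
    · rw [card_insert_of_notMem (by simp), ih]; omega
    · rw [ih]; omega

theorem residueCount_odd (a q y : ℕ) (ha : a % 2 = 1) (hq : q % 2 = 1) (ha8 : a < 8) :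
    residueCount 8 a q y = (y + 8 - (a * (q % 8)) % 8) / 8 := by
  have hq8 : q % 8 = 1 ∨ q % 8 = 3 ∨ q % 8 = 5 ∨ q % 8 = 7 := by omega
  have ha' : a = 1 ∨ a = 3 ∨ a = 5 ∨ a = 7 := by omega
  rw [← card_filter_mod_eight _ _ (by rcases hq8 with h | h | h | h <;> rw [h] <;> omega) (by omega),
    residueCount]
  congr 1
  refine filter_congr fun k _ ↦ ?_
  rw [Nat.mul_mod]
  rcases hq8 with h | h | h | h <;> rw [h] <;> omega

theorem residueCount_even (a q y : ℕ) (ha : a % 2 = 1) (hq : q % 2 = 0) :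
    residueCount 8 a q y = 0 := by
  rw [residueCount, card_eq_zero, filter_eq_empty_iff]
  intro k _ h
  obtain ⟨l, rfl⟩ := Nat.dvd_of_mod_eq_zero hq
  rw [mul_assoc] at h
  omega

theorem residueCount_one (q y : ℕ) : residueCount 1 0 q y = y := by
  simp [residueCount, Nat.mod_one]

/-- The integer combination of residue counts attached to the class of primes `5 mod 8`. -/
def chebyshevWeight (q y : ℕ) : ℤ :=
  residueCount 8 5 q y - residueCount 8 5 q (y / 2) - residueCount 8 7 q (y / 3)
    - residueCount 8 1 q (y / 5) - residueCount 8 3 q (y / 6) - residueCount 8 1 q (y / 15)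
    - residueCount 8 5 q (y / 15) - residueCount 8 7 q (y / 15)
    + residueCount 1 0 q (y / 24) + residueCount 1 0 q (y / 120)

/-- The combination of logarithmic sums whose coefficients over `Λ` are `chebyshevWeight`. -/
noncomputable def chebyshevSum (X : ℕ) : ℝ :=
  logSum 8 5 X - logSum 8 5 (X / 2) - logSum 8 7 (X / 3)
    - logSum 8 1 (X / 5) - logSum 8 3 (X / 6) - logSum 8 1 (X / 15)
    - logSum 8 5 (X / 15) - logSum 8 7 (X / 15)
    + logSum 1 0 (X / 24) + logSum 1 0 (X / 120)

theorem chebyshevSum_eq (X : ℕ) :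
    chebyshevSum X = ∑ q ∈ Ioc 0 X, vonMangoldt q * (chebyshevWeight q (X / q) : ℝ) := by
  have key (m a d : ℕ) : logSum m a (X / d) =
      ∑ q ∈ Ioc 0 X, vonMangoldt q * residueCount m a q (X / q / d) := by
    rw [logSum_eq_sum_vonMangoldt m a (Nat.div_le_self X d)]
    simp only [Nat.div_div_eq_div_mul, mul_comm d]
  rw [chebyshevSum, logSum_eq_sum_vonMangoldt 8 5 le_rfl]
  simp only [key, ← sum_sub_distrib, ← sum_add_distrib]
  refine sum_congr rfl fun q _ ↦ ?_
  rw [chebyshevWeight]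
  push_cast
  ring

theorem chebyshevWeight_even {q : ℕ} (y : ℕ) (hq : q % 2 = 0) :
    chebyshevWeight q y = (y / 24 : ℕ) + (y / 120 : ℕ) := by
  simp [chebyshevWeight, residueCount_one, residueCount_even, hq]

/-- An explicit form of `chebyshevWeight` for odd `q` with `q % 8 = b`. -/
def oddWeight (b y : ℕ) : ℤ :=
  ((y + 8 - 5 * b % 8) / 8 : ℕ) - ((y / 2 + 8 - 5 * b % 8) / 8 : ℕ)
    - ((y / 3 + 8 - 7 * b % 8) / 8 : ℕ) - ((y / 5 + 8 - 1 * b % 8) / 8 : ℕ)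
    - ((y / 6 + 8 - 3 * b % 8) / 8 : ℕ) - ((y / 15 + 8 - 1 * b % 8) / 8 : ℕ)
    - ((y / 15 + 8 - 5 * b % 8) / 8 : ℕ) - ((y / 15 + 8 - 7 * b % 8) / 8 : ℕ)
    + (y / 24 : ℕ) + (y / 120 : ℕ)

theorem chebyshevWeight_odd {q : ℕ} (y : ℕ) (hq : q % 2 = 1) :
    chebyshevWeight q y = oddWeight (q % 8) y := by
  simp only [chebyshevWeight, residueCount_one, residueCount_odd _ q _ _ hq, oddWeight,
    Nat.reduceMod, Nat.reduceLT]

theorem oddWeight_periodic (b y : ℕ) : oddWeight b (y + 240) = oddWeight b y := by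
  have key (y r t : ℕ) : (y + 8 * t + 8 - r % 8) / 8 = (y + 8 - r % 8) / 8 + t := by omega
  have h1 := key y (5 * b) 30
  have h2 := key (y / 2) (5 * b) 15
  have h3 := key (y / 3) (7 * b) 10
  have h5 := key (y / 5) (1 * b) 6
  have h6 := key (y / 6) (3 * b) 5
  have h7 := key (y / 15) (1 * b) 2
  have h8 := key (y / 15) (5 * b) 2
  have h9 := key (y / 15) (7 * b) 2
  simp only [Nat.reduceMul] at h1 h2 h3 h5 h6 h7 h8 h9
  rw [oddWeight, oddWeight, show (y + 240) / 2 = y / 2 + 120 by omega,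
    show (y + 240) / 3 = y / 3 + 80 by omega, show (y + 240) / 5 = y / 5 + 48 by omega,
    show (y + 240) / 6 = y / 6 + 40 by omega, show (y + 240) / 15 = y / 15 + 16 by omega,
    show (y + 240) / 24 = y / 24 + 10 by omega, show (y + 240) / 120 = y / 120 + 2 by omega,
    h1, h2, h3, h5, h6, h7, h8, h9]
  push_cast
  ring

theorem oddWeight_mod (b y : ℕ) : oddWeight b y = oddWeight b (y % 240) := by
  induction y using Nat.strong_induction_on with
  | _ y ih =>
    rcases lt_or_ge y 240 with h | h
    · rw [Nat.mod_eq_of_lt h]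
    · obtain ⟨z, rfl⟩ := Nat.exists_eq_add_of_le' h
      rw [oddWeight_periodic, ih z (by omega), Nat.add_mod_right]

set_option maxRecDepth 20000 in
theorem oddWeight_le_one {b : ℕ} (hb : b % 2 = 1) (hb8 : b < 8) (y : ℕ) : oddWeight b y ≤ 1 := by
  have key : ∀ b < 8, b % 2 = 1 → ∀ y < 240, oddWeight b y ≤ 1 := by decide
  rw [oddWeight_mod]
  exact key b hb8 hb _ (Nat.mod_lt _ (by norm_num))

set_option maxRecDepth 20000 in
theorem oddWeight_nonpos {b y : ℕ} (hb : b % 2 = 1) (hb8 : b < 8) (hy : y ≤ 120)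
    (h : ¬(b = 5 ∧ y = 1)) : oddWeight b y ≤ 0 := by
  have key : ∀ b < 8, b % 2 = 1 → ∀ y < 121, ¬(b = 5 ∧ y = 1) → oddWeight b y ≤ 0 := by decide
  exact key b hb8 hb y (by omega) h

theorem sum_vonMangoldt_even_mul_div_le (N : ℕ) :
    ∑ q ∈ Ioc 0 N with q % 2 = 0, vonMangoldt q * (N / q : ℝ) ≤ N * Real.log 2 := by
  have hsub : ∑ q ∈ Ioc 0 N with q % 2 = 0, vonMangoldt q * (N / q : ℝ) ≤
      ∑ q ∈ (range N).image (fun j ↦ 2 ^ (j + 1)), vonMangoldt q * (N / q : ℝ) := by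
    rw [← sum_filter_ne_zero]
    refine sum_le_sum_of_subset_of_nonneg ?_ fun q _ _ ↦ by
      have := vonMangoldt_nonneg (n := q)
      positivity
    intro q hq
    simp only [mem_filter, mem_Ioc, mem_image, mem_range] at hq ⊢
    obtain ⟨⟨⟨h0, hN⟩, h2⟩, hne⟩ := hq
    obtain ⟨p, k, hp, hk, rfl⟩ := (isPrimePow_nat_iff q).mp
      (vonMangoldt_ne_zero_iff.mp (left_ne_zero_of_mul hne))
    have h2p : 2 ∣ p := Nat.prime_two.dvd_of_dvd_pow (Nat.dvd_of_mod_eq_zero h2)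
    obtain rfl := (Nat.prime_dvd_prime_iff_eq Nat.prime_two hp).mp h2p
    have : k < 2 ^ k := Nat.lt_two_pow_self
    exact ⟨k - 1, by omega, by rw [Nat.sub_add_cancel hk]⟩
  refine hsub.trans ?_
  rw [sum_image fun i _ j _ h ↦ by simpa using Nat.pow_right_injective le_rfl h]
  have hterm : ∀ j ∈ range N, vonMangoldt (2 ^ (j + 1)) * (N / (2 ^ (j + 1) : ℕ) : ℝ) =
      (N * Real.log 2 / 2) * (1 / 2 : ℝ) ^ j := by
    intro j _
    rw [vonMangoldt_apply_pow (by omega), vonMangoldt_apply_prime Nat.prime_two]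
    push_cast
    rw [one_div, inv_pow, pow_succ]
    field_simp
  rw [sum_congr rfl hterm, ← mul_sum]
  have hgeom : ∑ j ∈ range N, (1 / 2 : ℝ) ^ j ≤ 2 := by
    rw [geom_sum_eq (by norm_num), div_le_iff_of_neg (by norm_num)]
    have : (0 : ℝ) ≤ (1 / 2) ^ N := by positivity
    linarith
  have hpos : 0 ≤ N * Real.log 2 / 2 := by positivity
  nlinarith

theorem mul_log_sub_self_bounds {x y : ℝ} (hx : 0 < x) (hxy : x ≤ y) :
    (y - x) * Real.log x ≤ (y * Real.log y - y) - (x * Real.log x - x) ∧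
      (y * Real.log y - y) - (x * Real.log x - x) ≤ (y - x) * Real.log y := by
  have hy : 0 < y := hx.trans_le hxy
  have h1 : Real.log y - Real.log x ≤ y / x - 1 := by
    rw [← Real.log_div hy.ne' hx.ne']
    exact Real.log_le_sub_one_of_pos (by positivity)
  have h2 : Real.log x - Real.log y ≤ x / y - 1 := by
    rw [← Real.log_div hx.ne' hy.ne']
    exact Real.log_le_sub_one_of_pos (by positivity)
  have h1' := mul_le_mul_of_nonneg_left h1 hx.le
  have h2' := mul_le_mul_of_nonneg_left h2 hy.le
  rw [mul_sub, mul_sub, mul_div_cancel₀ _ hx.ne'] at h1'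
  rw [mul_sub, mul_sub, mul_div_cancel₀ _ hy.ne'] at h2'
  constructor <;> linarith

theorem exists_residue_Ioc {m a : ℕ} (ha : a < m) (N : ℕ) :
    ∃ k ∈ Ioc N (N + m), {n ∈ Ioc N (N + m) | n % m = a} = {k} := by
  have hm : 0 < m := by omega
  have h : #{n ∈ Ioc N (N + m) | n % m = a} = 1 := by
    have hcard := Nat.Ioc_filter_modEq_card N (N + m) hm a
    have hm' : (m : ℚ) ≠ 0 := by positivity
    rw [show ((N + m : ℕ) - a : ℚ) / m = (N - a : ℚ) / m + 1 by push_cast; field_simp; ring,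
      Int.floor_add_one] at hcard
    simp only [Nat.ModEq, Nat.mod_eq_of_lt ha] at hcard
    omega
  obtain ⟨k, hk⟩ := card_eq_one.mp h
  exact ⟨k, (mem_filter.mp (hk ▸ mem_singleton_self k)).1, hk⟩

theorem logSum_add {m a : ℕ} (ha : a < m) (N : ℕ) :
    ∃ k, N < k ∧ k ≤ N + m ∧ logSum m a (N + m) = logSum m a N + Real.log k := by
  obtain ⟨k, hk, h⟩ := exists_residue_Ioc ha N
  rw [mem_Ioc] at hk
  refine ⟨k, hk.1, hk.2, ?_⟩
  rw [logSum, logSum, ← Ioc_union_Ioc_eq_Ioc (Nat.zero_le N) (Nat.le_add_right N m),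
    filter_union, sum_union, h, sum_singleton]
  exact disjoint_filter_filter (Ioc_disjoint_Ioc_of_le le_rfl)

theorem logSum_nonneg (m a N : ℕ) : 0 ≤ logSum m a N :=
  sum_nonneg fun n _ ↦ Real.log_natCast_nonneg n

theorem logSum_le_log {m a N : ℕ} (ha : a < m) (hN : N ≤ m) : logSum m a N ≤ Real.log N := by
  obtain ⟨k, -, h⟩ := exists_residue_Ioc ha 0
  have hcard : #{n ∈ Ioc 0 N | n % m = a} ≤ 1 := by
    rw [← card_singleton k, ← h, zero_add]
    exact card_le_card (filter_subset_filter _ (Ioc_subset_Ioc_right hN))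
  calc logSum m a N ≤ #{n ∈ Ioc 0 N | n % m = a} • Real.log N := by
        refine sum_le_card_nsmul _ _ _ fun n hn ↦ ?_
        simp only [mem_filter, mem_Ioc] at hn
        exact Real.log_le_log (mod_cast hn.1.1) (mod_cast hn.1.2)
    _ ≤ 1 • Real.log N := nsmul_le_nsmul_left (Real.log_natCast_nonneg N) hcard
    _ = Real.log N := one_nsmul _

theorem logSum_bounds {m a : ℕ} (ha : a < m) {N : ℕ} (hN : 1 ≤ N) :
    (N * Real.log N - N) - m * Real.log N ≤ m * logSum m a N ∧
      m * logSum m a N ≤ (N * Real.log N - N) + m * Real.log N + 1 := by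
  induction N using Nat.strong_induction_on with
  | _ N ih =>
    have hN0 : (1 : ℝ) ≤ N := mod_cast hN
    have hlog : 0 ≤ Real.log N := Real.log_natCast_nonneg N
    rcases le_or_gt N m with h | h
    · have hNm : (N : ℝ) ≤ m := mod_cast h
      have h1 := mul_le_mul_of_nonneg_left (logSum_le_log ha h) (Nat.cast_nonneg (α := ℝ) m)
      have h2 := mul_nonneg (Nat.cast_nonneg (α := ℝ) m) (logSum_nonneg m a N)
      have h3 := mul_le_mul_of_nonneg_right hNm hlog
      have h4 := (mul_log_sub_self_bounds one_pos hN0).1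
      rw [Real.log_one] at h4
      constructor <;> linarith
    · obtain ⟨M, rfl⟩ := Nat.exists_eq_add_of_lt h
      obtain ⟨k, hk1, hk2, hk⟩ := logSum_add ha (M + 1)
      obtain ⟨ih1, ih2⟩ := ih (M + 1) (by omega) (by omega)
      rw [show m + M + 1 = M + 1 + m by omega, hk]
      have hM : (0 : ℝ) < (M + 1 : ℕ) := by positivity
      obtain ⟨h1, h2⟩ := mul_log_sub_self_bounds hM
        (show ((M + 1 : ℕ) : ℝ) ≤ (M + 1 + m : ℕ) by exact_mod_cast Nat.le_add_right _ _)
      have hm : (0 : ℝ) ≤ m := Nat.cast_nonneg m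
      have h3 := mul_le_mul_of_nonneg_left (Real.log_le_log hM
        (show ((M + 1 : ℕ) : ℝ) ≤ k by exact_mod_cast hk1.le)) hm
      have h4 := mul_le_mul_of_nonneg_left (Real.log_le_log (hM.trans_le
        (show ((M + 1 : ℕ) : ℝ) ≤ k by exact_mod_cast hk1.le))
        (show (k : ℝ) ≤ (M + 1 + m : ℕ) by exact_mod_cast hk2)) hm
      have hsub : ((M + 1 + m : ℕ) : ℝ) - (M + 1 : ℕ) = m := by push_cast; ring
      rw [hsub] at h1 h2
      constructor <;> linarith

theorem logSum_div_bounds {m a : ℕ} (ha : a < m) {X d : ℕ} (hd : 0 < d) (hX : d ≤ X) :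
    (X / d : ℝ) * (Real.log X - Real.log d) - X / d - (m + 1) * Real.log X
        ≤ m * logSum m a (X / d) ∧
      m * logSum m a (X / d) ≤
        (X / d : ℝ) * (Real.log X - Real.log d) - X / d + m * Real.log X + 1 := by
  have hN : 1 ≤ X / d := Nat.div_pos hX hd
  have hd' : (0 : ℝ) < d := mod_cast hd
  have hX' : (0 : ℝ) < X := mod_cast hd.trans_le hX
  have hN' : (1 : ℝ) ≤ (X / d : ℕ) := mod_cast hN
  have hle : ((X / d : ℕ) : ℝ) ≤ X / d := Nat.cast_div_le
  have hlt : (X / d : ℝ) < (X / d : ℕ) + 1 := by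
    rw [div_lt_iff₀ hd']
    have := Nat.lt_mul_div_succ X hd
    rw [mul_comm] at this
    exact_mod_cast this
  obtain ⟨h1, h2⟩ := logSum_bounds ha hN
  obtain ⟨h3, h4⟩ := mul_log_sub_self_bounds (by linarith) hle
  have hlogN : 0 ≤ Real.log (X / d : ℕ) := Real.log_natCast_nonneg _
  have hlogX : Real.log (X / d : ℝ) ≤ Real.log X :=
    Real.log_le_log (by positivity) (div_le_self hX'.le (mod_cast hd))
  have hlogNX : Real.log (X / d : ℕ) ≤ Real.log (X / d : ℝ) := Real.log_le_log (by linarith) hle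
  have h5 : (X / d - (X / d : ℕ) : ℝ) * Real.log (X / d : ℝ) ≤ 1 * Real.log X :=
    mul_le_mul (by linarith) hlogX (hlogN.trans hlogNX) zero_le_one
  have h6 : 0 ≤ (X / d - (X / d : ℕ) : ℝ) * Real.log (X / d : ℕ) :=
    mul_nonneg (by linarith) hlogN
  have h7 := mul_le_mul_of_nonneg_left (hlogNX.trans hlogX) (Nat.cast_nonneg (α := ℝ) m)
  rw [← Real.log_div hX'.ne' hd'.ne']
  constructor <;> linarith

theorem chebyshevSum_ge {X : ℕ} (hX : 120 ≤ X) :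
    X * (20 * Real.log 5 + 18 * Real.log 3 - 32 * Real.log 2) / 60 - 97 * Real.log X - 7
      ≤ 8 * chebyshevSum X := by
  have h1 := (logSum_div_bounds (m := 8) (a := 5) (by norm_num) one_pos (by omega : 1 ≤ X)).1
  have h2 := (logSum_div_bounds (m := 8) (a := 5) (by norm_num) two_pos (by omega : 2 ≤ X)).2
  have h3 := (logSum_div_bounds (m := 8) (a := 7) (d := 3) (by norm_num) (by norm_num)
    (by omega : 3 ≤ X)).2
  have h4 := (logSum_div_bounds (m := 8) (a := 1) (d := 5) (by norm_num) (by norm_num)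
    (by omega : 5 ≤ X)).2
  have h5 := (logSum_div_bounds (m := 8) (a := 3) (d := 6) (by norm_num) (by norm_num)
    (by omega : 6 ≤ X)).2
  have h6 (a : ℕ) (ha : a < 8) := (logSum_div_bounds (d := 15) ha (by norm_num)
    (by omega : 15 ≤ X)).2
  have h7 := h6 1 (by norm_num)
  have h8 := h6 5 (by norm_num)
  have h9 := h6 7 (by norm_num)
  have h10 := (logSum_div_bounds (m := 1) (a := 0) (d := 24) (by norm_num) (by norm_num)
    (by omega : 24 ≤ X)).1
  have h11 := (logSum_div_bounds (m := 1) (a := 0) (d := 120) (by norm_num) (by norm_num) hX).1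
  have e6 : Real.log 6 = Real.log 2 + Real.log 3 := by
    rw [← Real.log_mul (by norm_num) (by norm_num)]; norm_num
  have e15 : Real.log 15 = Real.log 3 + Real.log 5 := by
    rw [← Real.log_mul (by norm_num) (by norm_num)]; norm_num
  have e24 : Real.log 24 = 3 * Real.log 2 + Real.log 3 := by
    rw [show (24 : ℝ) = 2 ^ 3 * 3 by norm_num, Real.log_mul (by norm_num) (by norm_num),
      Real.log_pow]
    norm_num
  have e120 : Real.log 120 = 3 * Real.log 2 + Real.log 3 + Real.log 5 := by
    rw [show (120 : ℝ) = 24 * 5 by norm_num, Real.log_mul (by norm_num) (by norm_num), e24]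
  push_cast at h1 h2 h3 h4 h5 h7 h8 h9 h10 h11
  rw [Real.log_one, Nat.div_one] at h1
  rw [e6] at h5
  rw [e15] at h7 h8 h9
  rw [e24] at h10
  rw [e120] at h11
  rw [chebyshevSum]
  linarith

open Chebyshev in
theorem chebyshevSum_le {X : ℕ} (hX : 120 ≤ X)
    (hno : ∀ p : ℕ, p.Prime → p % 8 = 5 → X < 2 * p → X < p) :
    chebyshevSum X ≤ psi (X / 120) + (psi X - theta X) + X * Real.log 2 / 20 := by
  have hpsi : psi (X / 120 : ℝ) = ∑ q ∈ Ioc 0 X, if q ≤ X / 120 then vonMangoldt q else 0 := by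
    rw [psi, show ⌊(X / 120 : ℝ)⌋₊ = X / 120 by exact_mod_cast Nat.floor_div_eq_div (K := ℝ) X 120,
      ← sum_filter]
    refine sum_congr ?_ fun _ _ ↦ rfl
    ext q
    simp only [mem_filter, mem_Ioc]
    omega
  have hnp : psi X - theta X = ∑ q ∈ Ioc 0 X, if ¬q.Prime then vonMangoldt q else 0 := by
    rw [psi_sub_theta_eq_sum_not_prime, Nat.floor_natCast, sum_filter]
  have heven : ∑ q ∈ Ioc 0 X, (if q % 2 = 0 then vonMangoldt q * (X / q : ℝ) else 0) / 20
      ≤ X * Real.log 2 / 20 := by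
    rw [← sum_div, ← sum_filter]
    gcongr
    exact sum_vonMangoldt_even_mul_div_le X
  rw [chebyshevSum_eq, hpsi, hnp]
  refine le_trans ?_ (add_le_add_right heven _)
  rw [← sum_add_distrib, ← sum_add_distrib]
  refine sum_le_sum fun q hq ↦ ?_
  rw [mem_Ioc] at hq
  have hL : 0 ≤ vonMangoldt q := vonMangoldt_nonneg
  have hA : 0 ≤ if q ≤ X / 120 then vonMangoldt q else 0 := by split_ifs <;> simp
  have hB : 0 ≤ if ¬q.Prime then vonMangoldt q else 0 := by split_ifs <;> simp
  rcases Nat.mod_two_eq_zero_or_one q with h | h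
  · rw [if_pos h, chebyshevWeight_even _ h, mul_div_assoc]
    have hy : ((X / q / 24 : ℕ) + (X / q / 120 : ℕ) : ℝ) ≤ X / q / 20 := by
      have h1 : ((X / q / 24 : ℕ) : ℝ) ≤ (X / q : ℕ) / 24 := Nat.cast_div_le
      have h2 : ((X / q / 120 : ℕ) : ℝ) ≤ (X / q : ℕ) / 120 := Nat.cast_div_le
      have h3 : ((X / q : ℕ) : ℝ) ≤ X / q := Nat.cast_div_le
      linarith
    have := mul_le_mul_of_nonneg_left hy hL
    rw [Int.cast_add, Int.cast_natCast, Int.cast_natCast]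
    linarith
  · rw [if_neg (by omega : ¬q % 2 = 0), chebyshevWeight_odd _ h, zero_div, add_zero]
    have hb : q % 8 % 2 = 1 := by omega
    have hb8 : q % 8 < 8 := Nat.mod_lt _ (by norm_num)
    have hone : vonMangoldt q * (oddWeight (q % 8) (X / q) : ℝ) ≤ vonMangoldt q :=
      mul_le_of_le_one_right hL (mod_cast oddWeight_le_one hb hb8 _)
    by_cases hlarge : q ≤ X / 120
    · rw [if_pos hlarge]
      linarith
    · by_cases h51 : q % 8 = 5 ∧ X / q = 1
      · have hp : ¬q.Prime := by
          intro hp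
          have := hno q hp h51.1 (by
            have := Nat.lt_mul_div_succ X hq.1
            rw [h51.2] at this
            omega)
          omega
        rw [if_pos hp]
        linarith
      · have hy : X / q ≤ 120 := by
          by_contra! hy
          rw [Nat.lt_iff_add_one_le, Nat.le_div_iff_mul_le hq.1] at hy
          omega
        have hw : (oddWeight (q % 8) (X / q) : ℝ) ≤ 0 :=
          mod_cast oddWeight_nonpos hb hb8 hy h51
        have := mul_nonpos_of_nonneg_of_nonpos hL hw
        linarith

theorem log_le_mul_of_fourth_power {t : ℝ} (ht : 128 ≤ t) : Real.log (t ^ 4) ≤ 0.2 * t := by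
  have h1 : Real.log (t / 128) ≤ t / 128 - 1 := Real.log_le_sub_one_of_pos (by linarith)
  rw [Real.log_div (by linarith) (by norm_num), show (128 : ℝ) = 2 ^ 7 by norm_num, Real.log_pow]
    at h1
  rw [Real.log_pow]
  push_cast at h1 ⊢
  have := Real.log_two_lt_d9
  linarith

open Chebyshev in
theorem exists_prime_five_mod_eight_of_large {X : ℕ} (hX : 2 ^ 28 ≤ X) :
    ∃ p : ℕ, p.Prime ∧ p % 8 = 5 ∧ X < 2 * p ∧ p ≤ X := by
  by_contra! hno
  have hX' : (2 : ℝ) ^ 28 ≤ X := mod_cast hX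
  have hX1 : (1 : ℝ) ≤ X / 120 := by linarith
  have hupper := chebyshevSum_le (by omega) hno
  have hlower := chebyshevSum_ge (by omega : 120 ≤ X)
  have hpsi := psi_le hX1
  have htheta := psi_sub_theta_le (by linarith : (1 : ℝ) ≤ X)
  have hlog : 20 * Real.log 5 + 18 * Real.log 3 ≥ 74 * Real.log 2 := by
    have h : Real.log (2 ^ 74) ≤ Real.log (5 ^ 20 * 3 ^ 18) :=
      Real.log_le_log (by norm_num) (by norm_num)
    rw [Real.log_mul (by norm_num) (by norm_num), Real.log_pow, Real.log_pow, Real.log_pow] at h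
    exact_mod_cast h
  rw [show (4 : ℝ) = 2 ^ 2 by norm_num, Real.log_pow] at hpsi
  have hsmall : 2 * √(X / 120 : ℝ) * Real.log (X / 120) ≤ 2 * √(X : ℝ) * Real.log X := by
    have : (X / 120 : ℝ) ≤ X := by linarith
    have := Real.log_nonneg hX1
    gcongr
  have hmain := mul_le_mul_of_nonneg_left hlog (by linarith : (0 : ℝ) ≤ X)
  obtain ⟨t, ht, hXt⟩ : ∃ t : ℝ, 128 ≤ t ∧ (X : ℝ) = t ^ 4 := by
    refine ⟨√√(X : ℝ), ?_, ?_⟩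
    · rw [Real.le_sqrt' (by norm_num), Real.le_sqrt' (by norm_num)]
      norm_num at hX' ⊢
      exact hX'
    · rw [show √√(X : ℝ) ^ 4 = (√√(X : ℝ) ^ 2) ^ 2 by ring, Real.sq_sqrt (by positivity),
        Real.sq_sqrt (by positivity)]
  have hsqrt : √(X : ℝ) = t ^ 2 := by
    rw [hXt, show t ^ 4 = (t ^ 2) ^ 2 by ring, Real.sqrt_sq (by positivity)]
  have hlogX : Real.log X ≤ 0.2 * t := hXt ▸ log_le_mul_of_fourth_power ht
  have h2 := Real.log_two_gt_d9
  have hbound : √(X : ℝ) * Real.log X ≤ t ^ 2 * (0.2 * t) := by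
    rw [hsqrt]
    gcongr
  have h3 : t ^ 4 * 0.693 ≤ X * Real.log 2 := by
    rw [← hXt]
    gcongr
    linarith
  nlinarith

theorem exists_prime_five_mod_eight_of_small {n : ℕ} (hn : 15 ≤ n) (hn' : n < 2 ^ 27) :
    ∃ p : ℕ, p.Prime ∧ n ≤ p ∧ p < 2 * n ∧ p % 8 = 5 := by
  by_contra! hno
  have step (p : ℕ) (hp : p.Prime) (h8 : p % 8 = 5) (h : p < 2 * n) : p < n := by
    by_contra! hle
    exact hno p hp hle h h8
  have h1 := step 29 (by norm_num) (by norm_num) (by omega)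
  have h2 := step 53 (by norm_num) (by norm_num) (by omega)
  have h3 := step 101 (by norm_num) (by norm_num) (by omega)
  have h4 := step 197 (by norm_num) (by norm_num) (by omega)
  have h5 := step 389 (by norm_num) (by norm_num) (by omega)
  have h6 := step 773 (by norm_num) (by norm_num) (by omega)
  have h7 := step 1493 (by norm_num) (by norm_num) (by omega)
  have h8 := step 2957 (by norm_num) (by norm_num) (by omega)
  have h9 := step 5869 (by norm_num) (by norm_num) (by omega)
  have h10 := step 11717 (by norm_num) (by norm_num) (by omega)
  have h11 := step 23357 (by norm_num) (by norm_num) (by omega)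
  have h12 := step 46589 (by norm_num) (by norm_num) (by omega)
  have h13 := step 93133 (by norm_num) (by norm_num) (by omega)
  have h14 := step 186253 (by norm_num) (by norm_num) (by omega)
  have h15 := step 372461 (by norm_num) (by norm_num) (by omega)
  have h16 := step 744917 (by norm_num) (by norm_num) (by omega)
  have h17 := step 1489781 (by norm_num) (by norm_num) (by omega)
  have h18 := step 2979541 (by norm_num) (by norm_num) (by omega)
  have h19 := step 5958893 (by norm_num) (by norm_num) (by omega)
  have h20 := step 11917781 (by norm_num) (by norm_num) (by omega)
  have h21 := step 23835517 (by norm_num) (by norm_num) (by omega)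
  have h22 := step 47670989 (by norm_num) (by norm_num) (by omega)
  have h23 := step 95341949 (by norm_num) (by norm_num) (by omega)
  have h24 := step 190683853 (by norm_num) (by norm_num) (by omega)
  omega

theorem bertrand_five_mod_eight (n : ℕ) (hn : 15 ≤ n) :
    ∃ p : ℕ, p.Prime ∧ n ≤ p ∧ p < 2 * n ∧ p % 8 = 5 := by
  rcases lt_or_ge n (2 ^ 27) with h | h
  · exact exists_prime_five_mod_eight_of_small hn h
  · obtain ⟨p, hp, h8, h1, h2⟩ := exists_prime_five_mod_eight_of_large (X := 2 * n) (by omega)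
    exact ⟨p, hp, by omega, by omega, h8⟩
end

section
/- For every integer n ≥ 2, there exists a prime number p with n ≤ p < 2n such that 2 is not a square in ZMod p (i.e., 2 is a quadratic nonresidue modulo p). -/
open Finset ArithmeticFunction

namespace BertrandTwo

/-- The indicator function of the residue classes `3` and `5` modulo `8`. -/
noncomputable def nonresInd (m : ℕ) : ℝ := if m % 8 = 3 ∨ m % 8 = 5 then 1 else 0

/-- The indicator function of the residue classes `1` and `7` modulo `8`. -/
noncomputable def resInd (m : ℕ) : ℝ := if m % 8 = 1 ∨ m % 8 = 7 then 1 else 0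

/-- The number of `k ≤ m` congruent to `3` or `5` modulo `8`. -/
def nonresCount (m : ℕ) : ℤ := ((m + 5) / 8 + (m + 3) / 8 : ℕ)

/-- The number of positive `k ≤ m` congruent to `1` or `7` modulo `8`. -/
def resCount (m : ℕ) : ℤ := ((m + 7) / 8 + (m + 1) / 8 : ℕ)

/-- The sum of `log m`, weighted by `f`, over positive `m ≤ M`. -/
noncomputable def logSum (f : ℕ → ℝ) (M : ℕ) : ℝ := ∑ m ∈ Ioc 0 M, f m * Real.log m

lemma sum_nonresInd (K : ℕ) : ∑ k ∈ Ioc 0 K, nonresInd k = nonresCount K := by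
  induction K with
  | zero => simp [nonresCount]
  | succ K ih =>
    rw [sum_Ioc_succ_top (Nat.zero_le K), ih]
    simp only [nonresInd, nonresCount]
    split_ifs with h
    · norm_cast; omega
    · norm_cast; omega

lemma sum_resInd (K : ℕ) : ∑ k ∈ Ioc 0 K, resInd k = resCount K := by
  induction K with
  | zero => simp [resCount]
  | succ K ih =>
    rw [sum_Ioc_succ_top (Nat.zero_le K), ih]
    simp only [resInd, resCount]
    split_ifs with h
    · norm_cast; omega
    · norm_cast; omega

lemma nonresInd_mul (d k : ℕ) :
    nonresInd (d * k) = nonresInd d * resInd k + resInd d * nonresInd k := by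
  simp only [nonresInd, resInd, Nat.mul_mod d k 8]
  have hd : d % 8 < 8 := Nat.mod_lt _ (by norm_num)
  have hk : k % 8 < 8 := Nat.mod_lt _ (by norm_num)
  generalize d % 8 = a at *
  generalize k % 8 = b at *
  interval_cases a <;> interval_cases b <;> norm_num

lemma resInd_mul (d k : ℕ) :
    resInd (d * k) = nonresInd d * nonresInd k + resInd d * resInd k := by
  simp only [nonresInd, resInd, Nat.mul_mod d k 8]
  have hd : d % 8 < 8 := Nat.mod_lt _ (by norm_num)
  have hk : k % 8 < 8 := Nat.mod_lt _ (by norm_num)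
  generalize d % 8 = a at *
  generalize k % 8 = b at *
  interval_cases a <;> interval_cases b <;> norm_num

lemma logSum_eq_sum_vonMangoldt (f : ℕ → ℝ) {M N : ℕ} (h : M ≤ N) :
    logSum f M = ∑ d ∈ Ioc 0 N, Λ d * ∑ k ∈ Ioc 0 (M / d), f (d * k) := by
  have h1 : logSum f M = ∑ m ∈ Ioc 0 M, ∑ d ∈ m.divisors, f m * Λ d := by
    refine sum_congr rfl fun m _ => ?_
    rw [← vonMangoldt_sum, mul_sum]
  rw [h1, sum_sigma']
  simp_rw [mul_sum]
  rw [sum_sigma']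
  refine sum_bij' (fun x _ => ⟨x.2, x.1 / x.2⟩) (fun x _ => ⟨x.1 * x.2, x.1⟩) ?_ ?_ ?_ ?_ ?_
  · rintro ⟨m, d⟩ hx
    simp only [mem_sigma, mem_Ioc, Nat.mem_divisors] at hx ⊢
    obtain ⟨⟨hm, hM⟩, hd, -⟩ := hx
    have hdm := Nat.le_of_dvd hm hd
    have hd0 := Nat.pos_of_dvd_of_pos hd hm
    exact ⟨⟨hd0, by omega⟩, Nat.div_pos hdm hd0, Nat.div_le_div_right hM⟩
  · rintro ⟨d, k⟩ hx
    simp only [mem_sigma, mem_Ioc, Nat.mem_divisors] at hx ⊢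
    obtain ⟨⟨hd, hN⟩, hk, hkM⟩ := hx
    have := (Nat.le_div_iff_mul_le hd).1 hkM
    refine ⟨⟨by positivity, by rwa [mul_comm]⟩, dvd_mul_right _ _, by positivity⟩
  · rintro ⟨m, d⟩ hx
    simp only [mem_sigma, mem_Ioc, Nat.mem_divisors] at hx
    simp [Nat.mul_div_cancel' hx.2.1]
  · rintro ⟨d, k⟩ hx
    simp only [mem_sigma, mem_Ioc] at hx
    simp [Nat.mul_div_cancel_left _ hx.1.1]
  · rintro ⟨m, d⟩ hx
    simp only [mem_sigma, mem_Ioc, Nat.mem_divisors] at hx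
    simp [Nat.mul_div_cancel' hx.2.1, mul_comm]

lemma logSum_nonresInd {M N : ℕ} (h : M ≤ N) :
    logSum nonresInd M = ∑ d ∈ Ioc 0 N,
      Λ d * (nonresInd d * resCount (M / d) + resInd d * nonresCount (M / d)) := by
  rw [logSum_eq_sum_vonMangoldt _ h]
  simp_rw [nonresInd_mul, sum_add_distrib, ← mul_sum, sum_nonresInd, sum_resInd]

lemma logSum_resInd {M N : ℕ} (h : M ≤ N) :
    logSum resInd M = ∑ d ∈ Ioc 0 N,
      Λ d * (nonresInd d * nonresCount (M / d) + resInd d * resCount (M / d)) := by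
  rw [logSum_eq_sum_vonMangoldt _ h]
  simp_rw [resInd_mul, sum_add_distrib, ← mul_sum, sum_nonresInd, sum_resInd]

lemma resCount_mul_add (m q : ℕ) : resCount (8 * q + m) = resCount m + 2 * q := by
  simp only [resCount]; omega

lemma nonresCount_mul_add (m q : ℕ) : nonresCount (8 * q + m) = nonresCount m + 2 * q := by
  simp only [nonresCount]; omega

/-- The coefficient with which prime powers `d ≡ 3, 5 [MOD 8]`, `y = ⌊N / d⌋`, enter the
Chebyshev-type combination of logarithmic sums. -/
def nonresCoeff (y : ℕ) : ℤ :=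
  resCount y - resCount (y / 2) - nonresCount (y / 3) - nonresCount (y / 5) +
    nonresCount (y / 6) - resCount (y / 6) + nonresCount (y / 30)

/-- The coefficient with which prime powers `d ≡ 1, 7 [MOD 8]`, `y = ⌊N / d⌋`, enter the
Chebyshev-type combination of logarithmic sums. -/
def resCoeff (y : ℕ) : ℤ :=
  nonresCount y - nonresCount (y / 2) - resCount (y / 3) - resCount (y / 5) +
    resCount (y / 6) - nonresCount (y / 6) + resCount (y / 30)

lemma nonresCoeff_mod (y : ℕ) : nonresCoeff y = nonresCoeff (y % 240) := by
  obtain ⟨q, r, hr, rfl⟩ : ∃ q r, r < 240 ∧ y = 240 * q + r :=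
    ⟨y / 240, y % 240, Nat.mod_lt _ (by norm_num), (Nat.div_add_mod _ _).symm⟩
  have h : (240 * q + r) % 240 = r := by omega
  rw [h]
  simp only [nonresCoeff]
  rw [show 240 * q + r = 8 * (30 * q) + r by ring,
    show (8 * (30 * q) + r) / 2 = 8 * (15 * q) + r / 2 by omega,
    show (8 * (30 * q) + r) / 3 = 8 * (10 * q) + r / 3 by omega,
    show (8 * (30 * q) + r) / 5 = 8 * (6 * q) + r / 5 by omega,
    show (8 * (30 * q) + r) / 6 = 8 * (5 * q) + r / 6 by omega,
    show (8 * (30 * q) + r) / 30 = 8 * q + r / 30 by omega]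
  simp only [resCount_mul_add, nonresCount_mul_add]
  push_cast
  ring

lemma resCoeff_mod (y : ℕ) : resCoeff y = resCoeff (y % 240) := by
  obtain ⟨q, r, hr, rfl⟩ : ∃ q r, r < 240 ∧ y = 240 * q + r :=
    ⟨y / 240, y % 240, Nat.mod_lt _ (by norm_num), (Nat.div_add_mod _ _).symm⟩
  have h : (240 * q + r) % 240 = r := by omega
  rw [h]
  simp only [resCoeff]
  rw [show 240 * q + r = 8 * (30 * q) + r by ring,
    show (8 * (30 * q) + r) / 2 = 8 * (15 * q) + r / 2 by omega,
    show (8 * (30 * q) + r) / 3 = 8 * (10 * q) + r / 3 by omega,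
    show (8 * (30 * q) + r) / 5 = 8 * (6 * q) + r / 5 by omega,
    show (8 * (30 * q) + r) / 6 = 8 * (5 * q) + r / 6 by omega,
    show (8 * (30 * q) + r) / 30 = 8 * q + r / 30 by omega]
  simp only [resCount_mul_add, nonresCount_mul_add]
  push_cast
  ring

lemma nonresCoeff_le (y : ℕ) : nonresCoeff y ≤
    (if y = 1 then 1 else 0) + (if 13 ≤ y then 1 else 0) + (if 61 ≤ y then 1 else 0) := by
  have small : ∀ y < 61, nonresCoeff y ≤
    (if y = 1 then 1 else 0) + (if 13 ≤ y then 1 else 0) + (if 61 ≤ y then 1 else 0) := by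
    decide +kernel
  have large : ∀ y < 240, nonresCoeff y ≤ 2 := by decide +kernel
  rcases lt_or_ge y 61 with h | h
  · exact small y h
  · rw [nonresCoeff_mod, if_neg (by omega), if_pos (by omega), if_pos h]
    exact large _ (Nat.mod_lt _ (by norm_num))

lemma resCoeff_le (y : ℕ) :
    resCoeff y ≤ (if 13 ≤ y then 1 else 0) + (if 61 ≤ y then 1 else 0) := by
  have small : ∀ y < 61,
      resCoeff y ≤ (if 13 ≤ y then 1 else 0) + (if 61 ≤ y then 1 else 0) := by
    decide +kernel
  have large : ∀ y < 240, resCoeff y ≤ 2 := by decide +kernel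
  rcases lt_or_ge y 61 with h | h
  · exact small y h
  · rw [resCoeff_mod, if_pos (by omega), if_pos h]
    exact large _ (Nat.mod_lt _ (by norm_num))

lemma abs_sum_mul_log_le (w : ℕ → ℝ) {B : ℝ} (hB : ∀ M, |∑ m ∈ Ioc 0 M, w m| ≤ B) (M : ℕ) :
    |logSum w M| ≤ 2 * B * Real.log (M + 1) := by
  have key : |logSum w M - (∑ m ∈ Ioc 0 M, w m) * Real.log (M + 1)| ≤
      B * Real.log (M + 1) := by
    induction M with
    | zero => simp [logSum]
    | succ M ih =>
      have hlog : Real.log (M + 1) ≤ Real.log (M + 1 + 1) :=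
        Real.log_le_log (by positivity) (by linarith)
      have hW := hB (M + 1)
      have hE : logSum w (M + 1) = logSum w M + w (M + 1) * Real.log (M + 1) := by
        simp [logSum, sum_Ioc_succ_top (Nat.zero_le M)]
      have hS := sum_Ioc_succ_top (Nat.zero_le M) w
      set S := ∑ m ∈ Ioc 0 M, w m
      set S' := ∑ m ∈ Ioc 0 (M + 1), w m
      push_cast
      calc |logSum w (M + 1) - S' * Real.log (M + 1 + 1)|
          = |(logSum w M - S * Real.log (M + 1)) -
              S' * (Real.log (M + 1 + 1) - Real.log (M + 1))| := by
            rw [hE, hS]; ring_nf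
        _ ≤ |logSum w M - S * Real.log (M + 1)| +
              |S' * (Real.log (M + 1 + 1) - Real.log (M + 1))| := abs_sub _ _
        _ ≤ B * Real.log (M + 1) + B * (Real.log (M + 1 + 1) - Real.log (M + 1)) := by
            rw [abs_mul S', abs_of_nonneg (sub_nonneg.2 hlog)]
            gcongr
        _ = _ := by ring
  have h0 : 0 ≤ Real.log ((M : ℝ) + 1) := Real.log_nonneg (by linarith [M.cast_nonneg (α := ℝ)])
  have h1 := mul_le_mul_of_nonneg_right (hB M) h0
  rw [← abs_of_nonneg h0, ← abs_mul, abs_of_nonneg h0] at h1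
  rw [abs_le] at *
  constructor <;> linarith

lemma abs_four_mul_logSum_nonresInd_sub_le (M : ℕ) :
    |4 * logSum nonresInd M - logSum 1 M| ≤ 6 * Real.log (M + 1) := by
  have h := abs_sum_mul_log_le (fun m => 4 * nonresInd m - 1) (B := 3) (fun M => by
    have h : -3 ≤ 4 * nonresCount M - M ∧ 4 * nonresCount M - M ≤ 3 := by
      simp only [nonresCount]; omega
    rw [sum_sub_distrib, ← mul_sum, sum_nonresInd, abs_le]
    simp only [sum_const, Nat.card_Ioc, nsmul_eq_mul, mul_one, Nat.sub_zero]
    exact_mod_cast h) M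
  have e : logSum (fun m => 4 * nonresInd m - 1) M = 4 * logSum nonresInd M - logSum 1 M := by
    simp only [logSum, mul_sum, ← sum_sub_distrib, Pi.one_apply]
    exact sum_congr rfl fun _ _ => by ring
  rw [e] at h
  linarith

lemma abs_four_mul_logSum_resInd_sub_le (M : ℕ) :
    |4 * logSum resInd M - logSum 1 M| ≤ 6 * Real.log (M + 1) := by
  have h := abs_sum_mul_log_le (fun m => 4 * resInd m - 1) (B := 3) (fun M => by
    have h : -3 ≤ 4 * resCount M - M ∧ 4 * resCount M - M ≤ 3 := by
      simp only [resCount]; omega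
    rw [sum_sub_distrib, ← mul_sum, sum_resInd, abs_le]
    simp only [sum_const, Nat.card_Ioc, nsmul_eq_mul, mul_one, Nat.sub_zero]
    exact_mod_cast h) M
  have e : logSum (fun m => 4 * resInd m - 1) M = 4 * logSum resInd M - logSum 1 M := by
    simp only [logSum, mul_sum, ← sum_sub_distrib, Pi.one_apply]
    exact sum_congr rfl fun _ _ => by ring
  rw [e] at h
  linarith

lemma one_sub_div_le_log_sub {a b : ℝ} (ha : 0 < a) (hb : 0 < b) :
    1 - a / b ≤ Real.log b - Real.log a := by
  have := Real.log_le_sub_one_of_pos (div_pos ha hb)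
  rw [Real.log_div ha.ne' hb.ne'] at this
  linarith

lemma mul_log_sub_self_mono {a b : ℝ} (ha : 1 ≤ a) (hab : a ≤ b) :
    a * Real.log a - a ≤ b * Real.log b - b := by
  have hb : 0 < b := by linarith
  have h := mul_le_mul_of_nonneg_left (one_sub_div_le_log_sub (a := a) (by linarith) hb) hb.le
  have e : b * (1 - a / b) = b - a := by field_simp
  have := mul_le_mul_of_nonneg_right hab (Real.log_nonneg ha)
  linarith

lemma le_logSum_one (M : ℕ) : (M : ℝ) * Real.log M - M ≤ logSum 1 M := by
  induction M with
  | zero => simp [logSum]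
  | succ M ih =>
    have hE : logSum 1 (M + 1) = logSum 1 M + Real.log (M + 1) := by
      simp [logSum, sum_Ioc_succ_top (Nat.zero_le M)]
    rw [hE]
    push_cast
    rcases M.eq_zero_or_pos with rfl | hM
    · simp [logSum]
    have hM' : (0 : ℝ) < M := by exact_mod_cast hM
    have h := one_sub_div_le_log_sub (a := (M : ℝ) + 1) (b := M) (by positivity) hM'
    have h2 := mul_le_mul_of_nonneg_left h hM'.le
    have e : (M : ℝ) * (1 - (M + 1) / M) = -1 := by field_simp; ring
    linarith

lemma logSum_one_le {M : ℕ} (hM : 1 ≤ M) :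
    logSum 1 M ≤ (M : ℝ) * Real.log M - M + 1 + Real.log M := by
  induction M, hM using Nat.le_induction with
  | base => simp [logSum]
  | succ M hM ih =>
    have hE : logSum 1 (M + 1) = logSum 1 M + Real.log (M + 1) := by
      simp [logSum, sum_Ioc_succ_top (Nat.zero_le M)]
    rw [hE]
    push_cast
    have hM' : (0 : ℝ) < M := by exact_mod_cast hM
    have h := one_sub_div_le_log_sub (a := (M : ℝ)) (b := M + 1) hM' (by positivity)
    have h2 := mul_le_mul_of_nonneg_left h (by positivity : (0 : ℝ) ≤ M + 1)
    have e : ((M : ℝ) + 1) * (1 - M / (M + 1)) = 1 := by field_simp; ring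
    linarith

lemma abs_logSum_one_floor_sub_le {y : ℝ} (hy : 1 ≤ y) :
    |logSum 1 ⌊y⌋₊ - (y * Real.log y - y)| ≤ 1 + Real.log (y + 1) := by
  have h1 : 1 ≤ ⌊y⌋₊ := Nat.one_le_floor_iff _ |>.2 hy
  have h1' : (1 : ℝ) ≤ ⌊y⌋₊ := by exact_mod_cast h1
  have hle : (⌊y⌋₊ : ℝ) ≤ y := Nat.floor_le (by linarith)
  have hlt := Nat.lt_floor_add_one y
  have hlog1 : Real.log ⌊y⌋₊ ≤ Real.log (y + 1) := Real.log_le_log (by linarith) (by linarith)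
  have hlog2 : Real.log (⌊y⌋₊ + 1) ≤ Real.log (y + 1) :=
    Real.log_le_log (by linarith) (by linarith)
  have hU := logSum_one_le h1
  have hL := le_logSum_one (⌊y⌋₊ + 1)
  have hE : logSum 1 (⌊y⌋₊ + 1) = logSum 1 ⌊y⌋₊ + Real.log (⌊y⌋₊ + 1) := by
    simp [logSum, sum_Ioc_succ_top (Nat.zero_le _)]
  rw [hE] at hL
  push_cast at hL
  have m1 := mul_log_sub_self_mono h1' hle
  have m2 := mul_log_sub_self_mono hy hlt.le
  rw [abs_le]
  constructor <;> linarith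

/-- The Chebyshev-type combination of logarithmic sums. -/
noncomputable def combination (N : ℕ) : ℝ :=
  logSum nonresInd N - logSum nonresInd (N / 2) - logSum resInd (N / 3) - logSum resInd (N / 5) +
    logSum resInd (N / 6) - logSum nonresInd (N / 6) + logSum resInd (N / 30)

lemma combination_eq (N : ℕ) : combination N = ∑ d ∈ Ioc 0 N,
    Λ d * (nonresInd d * nonresCoeff (N / d) + resInd d * resCoeff (N / d)) := by
  rw [combination, logSum_nonresInd le_rfl, logSum_nonresInd (N.div_le_self 2),
    logSum_resInd (N.div_le_self 3), logSum_resInd (N.div_le_self 5),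
    logSum_resInd (N.div_le_self 6), logSum_nonresInd (N.div_le_self 6),
    logSum_resInd (N.div_le_self 30)]
  simp only [← sum_sub_distrib, ← sum_add_distrib]
  refine sum_congr rfl fun d _ => ?_
  simp only [nonresCoeff, resCoeff, Nat.div_div_eq_div_mul, mul_comm d]
  push_cast
  ring

lemma combination_le {N : ℕ}
    (h : ∀ p : ℕ, p.Prime → N / 2 < p → p ≤ N → ¬ (p % 8 = 3 ∨ p % 8 = 5)) :
    combination N ≤ (Chebyshev.psi N - Chebyshev.theta N) + Chebyshev.psi (N / 13 : ℕ) +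
      Chebyshev.psi (N / 61 : ℕ) := by
  have hpsi : ∀ M ≤ N, Chebyshev.psi M = ∑ d ∈ Ioc 0 N, if d ≤ M then Λ d else 0 := by
    intro M hM
    rw [Chebyshev.psi, Nat.floor_natCast, ← sum_filter]
    refine sum_congr ?_ fun _ _ => rfl
    ext d
    simp only [mem_Ioc, mem_filter]
    omega
  rw [Chebyshev.psi_sub_theta_eq_sum_not_prime, Nat.floor_natCast, sum_filter,
    hpsi _ (N.div_le_self 13), hpsi _ (N.div_le_self 61), combination_eq, ← sum_add_distrib,
    ← sum_add_distrib]
  refine sum_le_sum fun d hd => ?_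
  obtain ⟨hd0, hdN⟩ := mem_Ioc.1 hd
  have h13 : d ≤ N / 13 ↔ 13 ≤ N / d := by
    rw [Nat.le_div_iff_mul_le (by norm_num), Nat.le_div_iff_mul_le hd0, mul_comm]
  have h61 : d ≤ N / 61 ↔ 61 ≤ N / d := by
    rw [Nat.le_div_iff_mul_le (by norm_num), Nat.le_div_iff_mul_le hd0, mul_comm]
  have hΛ : 0 ≤ Λ d := vonMangoldt_nonneg
  have hrhs : (if ¬ d.Prime then Λ d else 0) + (if d ≤ N / 13 then Λ d else 0) +
      (if d ≤ N / 61 then Λ d else 0) = Λ d * ((if ¬ d.Prime then 1 else 0) +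
        (if 13 ≤ N / d then 1 else 0) + (if 61 ≤ N / d then 1 else 0)) := by
    simp only [h13, h61, mul_add, mul_ite, mul_one, mul_zero]
  rw [hrhs]
  refine mul_le_mul_of_nonneg_left ?_ hΛ
  have hprime : (0 : ℝ) ≤ if ¬ d.Prime then 1 else 0 := by split_ifs <;> norm_num
  by_cases hn : d % 8 = 3 ∨ d % 8 = 5
  · have hr : ¬ (d % 8 = 1 ∨ d % 8 = 7) := by omega
    have hc : (nonresCoeff (N / d) : ℝ) ≤ (if N / d = 1 then 1 else 0) +
        (if 13 ≤ N / d then 1 else 0) + (if 61 ≤ N / d then 1 else 0) := by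
      exact_mod_cast nonresCoeff_le (N / d)
    have hone : (if N / d = 1 then (1 : ℝ) else 0) ≤ if ¬ d.Prime then 1 else 0 := by
      split_ifs with h1 h2 <;> try norm_num
      have : N < 2 * d := by
        have := Nat.lt_mul_div_succ N hd0
        rw [h1] at this
        linarith
      exact h d h2 (by omega) hdN hn
    simp only [nonresInd, resInd, if_pos hn, if_neg hr]
    linarith
  · by_cases hr : d % 8 = 1 ∨ d % 8 = 7
    · have hc : (resCoeff (N / d) : ℝ) ≤
          (if 13 ≤ N / d then 1 else 0) + (if 61 ≤ N / d then 1 else 0) := by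
        exact_mod_cast resCoeff_le (N / d)
      simp only [nonresInd, resInd, if_pos hr, if_neg hn]
      linarith
    · simp only [nonresInd, resInd, if_neg hr, if_neg hn]
      have h1 : (0 : ℝ) ≤ if 13 ≤ N / d then 1 else 0 := by split_ifs <;> norm_num
      have h2 : (0 : ℝ) ≤ if 61 ≤ N / d then 1 else 0 := by split_ifs <;> norm_num
      linarith

lemma abs_logSum_one_div_sub_le {N j : ℕ} (hj : 0 < j) (hjN : j ≤ N) :
    |logSum 1 (N / j) - (N / j * (Real.log N - Real.log j) - N / j : ℝ)| ≤
      1 + Real.log (N + 1) := by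
  have hj' : (1 : ℝ) ≤ j := by exact_mod_cast hj
  have hN' : (j : ℝ) ≤ N := by exact_mod_cast hjN
  have h := abs_logSum_one_floor_sub_le (y := (N : ℝ) / j) ((one_le_div (by linarith)).2 hN')
  rw [Nat.floor_div_eq_div, Real.log_div (by linarith) (by linarith)] at h
  have hle : (N : ℝ) / j ≤ N := div_le_self (by linarith) hj'
  have : Real.log ((N : ℝ) / j + 1) ≤ Real.log (N + 1) :=
    Real.log_le_log (by positivity) (by linarith)
  linarith

lemma le_combination {N : ℕ} (hN : 30 ≤ N) :
    0.3229 * Real.log 2 * N - 12 * Real.log (N + 1) - 2 ≤ combination N := by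
  have hlog : ∀ j : ℕ, Real.log ((N / j : ℕ) + 1) ≤ Real.log (N + 1) := fun j =>
    Real.log_le_log (by positivity) (by gcongr; exact N.div_le_self j)
  have hl0 : 0 ≤ Real.log ((N : ℝ) + 1) := Real.log_nonneg (by linarith [N.cast_nonneg (α := ℝ)])
  have n1 := abs_le.1 (abs_four_mul_logSum_nonresInd_sub_le N)
  have n2 := abs_le.1 ((abs_four_mul_logSum_nonresInd_sub_le (N / 2)))
  have r3 := abs_le.1 ((abs_four_mul_logSum_resInd_sub_le (N / 3)))
  have r5 := abs_le.1 ((abs_four_mul_logSum_resInd_sub_le (N / 5)))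
  have r6 := abs_le.1 ((abs_four_mul_logSum_resInd_sub_le (N / 6)))
  have n6 := abs_le.1 ((abs_four_mul_logSum_nonresInd_sub_le (N / 6)))
  have r30 := abs_le.1 ((abs_four_mul_logSum_resInd_sub_le (N / 30)))
  have l1 := abs_le.1 (abs_logSum_one_div_sub_le (N := N) (j := 1) (by norm_num) (by omega))
  have l2 := abs_le.1 (abs_logSum_one_div_sub_le (N := N) (j := 2) (by norm_num) (by omega))
  have l3 := abs_le.1 (abs_logSum_one_div_sub_le (N := N) (j := 3) (by norm_num) (by omega))
  have l5 := abs_le.1 (abs_logSum_one_div_sub_le (N := N) (j := 5) (by norm_num) (by omega))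
  have l30 := abs_le.1 (abs_logSum_one_div_sub_le (N := N) (j := 30) (by norm_num) (by omega))
  rw [Nat.div_one] at l1
  have e30 : Real.log 30 = Real.log 2 + Real.log 3 + Real.log 5 := by
    rw [← Real.log_mul (by norm_num) (by norm_num), ← Real.log_mul (by norm_num) (by norm_num)]
    norm_num
  have e3 : 3 * Real.log 2 ≤ 2 * Real.log 3 := by
    have := Real.log_le_log (x := 2 ^ 3) (y := 3 ^ 2) (by norm_num) (by norm_num)
    simpa [Real.log_pow] using this
  have e5 : 9 * Real.log 2 ≤ 4 * Real.log 5 := by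
    have := Real.log_le_log (x := 2 ^ 9) (y := 5 ^ 4) (by norm_num) (by norm_num)
    simpa [Real.log_pow] using this
  have e2 : 0 ≤ Real.log 2 := Real.log_nonneg (by norm_num)
  have hmain : 0.3229 * Real.log 2 * N ≤ (N : ℝ) / 4 *
      (Real.log 2 / 2 + Real.log 3 / 3 + Real.log 5 / 5 - Real.log 30 / 30) := by
    have : 0.3229 * Real.log 2 * N = (N : ℝ) * (0.3229 * Real.log 2) := by ring
    rw [this, div_mul_eq_mul_div, mul_div_assoc]
    refine mul_le_mul_of_nonneg_left ?_ N.cast_nonneg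
    rw [e30]
    linarith
  have h2 := hlog 2
  have h3 := hlog 3
  have h5 := hlog 5
  have h6 := hlog 6
  have h30 := hlog 30
  simp only [combination]
  push_cast at l1 l2 l3 l5 l30
  rw [Real.log_one] at l1
  ring_nf at *
  linarith

lemma log_add_one_le {x : ℝ} (hx : 2 ^ 20 ≤ x) : Real.log (x + 1) ≤ √x / 50 := by
  have hs : 1024 ≤ √x := Real.le_sqrt_of_sq_le (by linarith)
  have h1 : Real.log (x + 1) ≤ Real.log (2 * x) := Real.log_le_log (by linarith) (by linarith)
  rw [Real.log_mul (by norm_num) (by linarith)] at h1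
  have h2 : Real.log √x = Real.log x / 2 := Real.log_sqrt (by linarith)
  have h3 := Real.log_le_sub_one_of_pos (x := √x / 2 ^ 10) (by positivity)
  rw [Real.log_div (by linarith) (by norm_num), Real.log_pow] at h3
  have := Real.log_two_lt_d9
  push_cast at h3
  linarith

lemma psi_div_le {N j : ℕ} (hj : 0 < j) (hjN : j ≤ N) (c : ℝ) (hc : 0 < c) (hcj : c ^ 2 ≤ j) :
    Chebyshev.psi (N / j : ℕ) ≤ 2 * Real.log 2 * (N / j) + 2 * (√N / c) * Real.log (N + 1) := by
  have hM : (1 : ℝ) ≤ (N / j : ℕ) := by exact_mod_cast Nat.div_pos hjN hj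
  have h4 : Real.log 4 = 2 * Real.log 2 := by
    rw [show (4 : ℝ) = 2 ^ 2 by norm_num, Real.log_pow]; norm_num
  have hle : ((N / j : ℕ) : ℝ) ≤ N / j := Nat.cast_div_le
  have hs : √((N / j : ℕ) : ℝ) ≤ √N / c := by
    rw [le_div_iff₀ hc]
    refine Real.le_sqrt_of_sq_le ?_
    rw [mul_pow, Real.sq_sqrt (by positivity)]
    calc ((N / j : ℕ) : ℝ) * c ^ 2 ≤ (N / j) * j := by gcongr
      _ = N := div_mul_cancel₀ _ (Nat.cast_ne_zero.2 hj.ne')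
  have hl : Real.log (N / j : ℕ) ≤ Real.log (N + 1) :=
    Real.log_le_log (by linarith) (by
      have : ((N / j : ℕ) : ℝ) ≤ N := by exact_mod_cast N.div_le_self j
      linarith)
  have hl0 : 0 ≤ Real.log ((N / j : ℕ) : ℝ) := Real.log_nonneg hM
  have hl2 : 0 ≤ Real.log 2 := Real.log_nonneg (by norm_num)
  refine (Chebyshev.psi_le hM).trans ?_
  rw [h4]
  gcongr

/-- For large `N`, some prime in `(N / 2, N]` is congruent to `3` or `5` modulo `8`. -/
theorem exists_prime_mod_eight_of_large {N : ℕ} (hN : 2 ^ 20 ≤ N) :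
    ∃ p : ℕ, p.Prime ∧ N / 2 < p ∧ p ≤ N ∧ (p % 8 = 3 ∨ p % 8 = 5) := by
  by_contra! hcon
  have hup := combination_le (N := N) fun p hp h1 h2 => by
    have := hcon p hp h1 h2; omega
  have hlow := le_combination (N := N) (by omega)
  have hN' : (2 : ℝ) ^ 20 ≤ N := by exact_mod_cast hN
  have h13 := psi_div_le (N := N) (j := 13) (by norm_num) (by omega) 3 (by norm_num) (by norm_num)
  have h61 := psi_div_le (N := N) (j := 61) (by norm_num) (by omega) 6 (by norm_num) (by norm_num)
  have hpt := Chebyshev.psi_sub_theta_le (x := N) (by linarith)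
  have hl := log_add_one_le hN'
  have hs : 1024 ≤ √(N : ℝ) := Real.le_sqrt_of_sq_le (by linarith)
  have hsq : √(N : ℝ) * √N = N := Real.mul_self_sqrt (by positivity)
  have hll : Real.log N ≤ Real.log (N + 1) := Real.log_le_log (by linarith) (by linarith)
  have h1 : √(N : ℝ) * Real.log N ≤ √N * (√N / 50) :=
    mul_le_mul_of_nonneg_left (hll.trans hl) (by positivity)
  have h2 : √(N : ℝ) * Real.log (N + 1) ≤ √N * (√N / 50) :=
    mul_le_mul_of_nonneg_left hl (by positivity)
  have h3 : 1024 * √(N : ℝ) ≤ N :=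
    (mul_le_mul_of_nonneg_right hs (by positivity)).trans_eq hsq
  have h4 : 0.69 * (N : ℝ) ≤ Real.log 2 * N :=
    mul_le_mul_of_nonneg_right (by linarith [Real.log_two_gt_d9]) (by positivity)
  have e : √(N : ℝ) * (√N / 50) = N / 50 := by rw [← mul_div_assoc, hsq]
  rw [e] at h1 h2
  push_cast at h13 h61
  ring_nf at *
  linarith

lemma not_isSquare_two {p : ℕ} (hp : p.Prime) (h : p % 8 = 3 ∨ p % 8 = 5) :
    ¬ IsSquare (2 : ZMod p) := by
  have := Fact.mk hp
  rw [ZMod.exists_sq_eq_two_iff (by rintro rfl; omega)]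
  omega

end BertrandTwo

theorem bertrand_two_nonresidue (n : ℕ) (hn : 2 ≤ n) :
    ∃ p : ℕ, p.Prime ∧ n ≤ p ∧ p < 2 * n ∧ ¬ IsSquare (2 : ZMod p) := by
  suffices h : ∃ p : ℕ, p.Prime ∧ n ≤ p ∧ p < 2 * n ∧ (p % 8 = 3 ∨ p % 8 = 5) by
    obtain ⟨p, hp, h1, h2, h8⟩ := h
    exact ⟨p, hp, h1, h2, BertrandTwo.not_isSquare_two hp h8⟩
  by_cases hlarge : 2 ^ 20 ≤ n
  · obtain ⟨p, hp, h1, h2, h8⟩ :=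
      BertrandTwo.exists_prime_mod_eight_of_large (N := 2 * n - 1) (by omega)
    exact ⟨p, hp, by omega, by omega, h8⟩
  by_contra! hcon
  have chain : ∀ p : ℕ, p.Prime → (p % 8 = 3 ∨ p % 8 = 5) → n ≤ p → 2 * n ≤ p := by
    intro p hp h8 hnp
    by_contra! hlt
    have := hcon p hp hnp hlt
    omega
  have h0 : n ≤ 2012677 := by omega
  have c2012677 := chain 2012677 (by norm_num) (by norm_num) (by omega)
  have c1006339 := chain 1006339 (by norm_num) (by norm_num) (by omega)
  have c503227 := chain 503227 (by norm_num) (by norm_num) (by omega)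
  have c251621 := chain 251621 (by norm_num) (by norm_num) (by omega)
  have c125821 := chain 125821 (by norm_num) (by norm_num) (by omega)
  have c62939 := chain 62939 (by norm_num) (by norm_num) (by omega)
  have c31477 := chain 31477 (by norm_num) (by norm_num) (by omega)
  have c15749 := chain 15749 (by norm_num) (by norm_num) (by omega)
  have c7883 := chain 7883 (by norm_num) (by norm_num) (by omega)
  have c3947 := chain 3947 (by norm_num) (by norm_num) (by omega)
  have c1987 := chain 1987 (by norm_num) (by norm_num) (by omega)
  have c997 := chain 997 (by norm_num) (by norm_num) (by omega)
  have c499 := chain 499 (by norm_num) (by norm_num) (by omega)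
  have c251 := chain 251 (by norm_num) (by norm_num) (by omega)
  have c131 := chain 131 (by norm_num) (by norm_num) (by omega)
  have c67 := chain 67 (by norm_num) (by norm_num) (by omega)
  have c37 := chain 37 (by norm_num) (by norm_num) (by omega)
  have c19 := chain 19 (by norm_num) (by norm_num) (by omega)
  have c11 := chain 11 (by norm_num) (by norm_num) (by omega)
  have c5 := chain 5 (by norm_num) (by norm_num) (by omega)
  have c3 := chain 3 (by norm_num) (by norm_num) (by omega)
  omega
end

section
/- Define θ(x) = Σ log p, the sum taken over all primes p ≤ x with p ≡ 5 (mod 8). If for every real x ≥ 10^10 one has |θ(x) − x/4| ≤ 0.00456·(x/4), then for every real x ≥ 10^10 there exists a prime p with x < p ≤ 2x and p ≡ 5 (mod 8). -/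
open Finset

/-- The Chebyshev-type function for the arithmetic progression `5 mod 8`:
the sum of `log p` over all primes `p ≤ x` with `p ≡ 5 (mod 8)`. -/
noncomputable def thetaFiveModEight (x : ℝ) : ℝ :=
  ∑ p ∈ (Finset.range (⌊x⌋₊ + 1)).filter (fun p => Nat.Prime p ∧ p % 8 = 5),
    Real.log p

/-- If no prime `p ≡ 5 (mod 8)` lies in `(x, y]`, then `thetaFiveModEight` does not grow
from `x` to `y`. -/
theorem thetaFiveModEight_le_of_forall_not {x y : ℝ} (hy : 0 ≤ y)
    (hxy : ∀ p : ℕ, p.Prime → p % 8 = 5 → x < p → ¬ (p : ℝ) ≤ y) :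
    thetaFiveModEight y ≤ thetaFiveModEight x := by
  refine Finset.sum_le_sum_of_subset_of_nonneg ?_ fun p _ _ => Real.log_natCast_nonneg p
  intro p hp
  simp only [Finset.mem_filter, Finset.mem_range, Nat.lt_succ_iff] at hp ⊢
  obtain ⟨hpy, hprime, hmod⟩ := hp
  refine ⟨Nat.le_floor ?_, hprime, hmod⟩
  by_contra! hxp
  exact hxy p hprime hmod hxp ((Nat.le_floor_iff hy).1 hpy)

theorem prime_five_mod_eight_in_interval
    (h : ∀ x : ℝ, (10 : ℝ) ^ 10 ≤ x →
      |thetaFiveModEight x - x / 4| ≤ 0.00456 * (x / 4)) :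
    ∀ x : ℝ, (10 : ℝ) ^ 10 ≤ x →
      ∃ p : ℕ, p.Prime ∧ x < (p : ℝ) ∧ (p : ℝ) ≤ 2 * x ∧ p % 8 = 5 := by
  intro x hx
  by_contra! hno
  have hmono : thetaFiveModEight (2 * x) ≤ thetaFiveModEight x :=
    thetaFiveModEight_le_of_forall_not (by linarith) fun p hp hmod hxp hle =>
      hno p hp hxp hle hmod
  have hlower := (abs_le.1 (h (2 * x) (by linarith))).1
  have hupper := (abs_le.1 (h x hx)).2
  linarith
end

section
/- Let g ≥ 2 be an integer and p a prime with 2g+2 < p < 4g+4 such that 2 is not a square in ZMod p. Define Q(x) = x^{2g+2} − x^{(p−1)/2} + x^{2g+2−(p−1)/2} + 1 over ZMod p. Then for all x, y in ZMod p, y^2 = Q(x) holds if and only if x = 0 and (y = 1 or y = −1). -/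
theorem reduction_curve_points (g : ℕ) (hg : 2 ≤ g) (p : ℕ) (hp : p.Prime)
    (hlow : 2 * g + 2 < p) (hhigh : p < 4 * g + 4)
    (h2 : ¬ IsSquare (2 : ZMod p)) :
    ∀ x y : ZMod p,
      y ^ 2 = x ^ (2 * g + 2) - x ^ ((p - 1) / 2) + x ^ (2 * g + 2 - (p - 1) / 2) + 1 ↔
        x = 0 ∧ (y = 1 ∨ y = -1) := by
  intro x y
  have : Fact p.Prime := ⟨hp⟩
  have hodd : p % 2 = 1 := hp.eq_two_or_odd.resolve_left (by omega)
  have hhalf : p / 2 = (p - 1) / 2 := by omega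
  obtain ⟨k, hk⟩ : ∃ k, 2 * g + 2 = (p - 1) / 2 + k := Nat.exists_eq_add_of_le (by omega)
  have hk0 : k ≠ 0 := by omega
  have hm0 : (p - 1) / 2 ≠ 0 := by omega
  have hsub : 2 * g + 2 - (p - 1) / 2 = k := by omega
  have hsplit : x ^ (2 * g + 2) = x ^ ((p - 1) / 2) * x ^ k := by rw [hk, pow_add]
  have hsq : x ^ (2 * g + 2) = (x ^ (g + 1)) ^ 2 := by rw [← pow_mul]; ring
  rw [hsub]
  by_cases hx : x = 0
  · subst hx
    simp [hm0, hk0]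
  · refine iff_of_false (fun h => h2 ?_) (fun h => hx h.1)
    have hx' : x ^ (g + 1) ≠ 0 := pow_ne_zero _ hx
    rcases ZMod.pow_div_two_eq_neg_one_or_one p hx with he | he <;> rw [hhalf] at he <;>
      rw [he] at h hsplit
    · refine ⟨y / x ^ (g + 1), ?_⟩
      field_simp
      linear_combination -h - 2 * hsq + hsplit
    · exact ⟨y, by linear_combination -h - hsplit⟩
end
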